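/- arXiv:2201.07270 — 2 statements merged into one kernel-verified Lean document; each statement's English description precedes it below -/
import Mathlib

section
/- The monomial z_1^2⋯z_{k−1}^2 belongs to BD_k + span(L_k^1 ∪ L_k^2), and for every 1 ≤ i ≤ k−1 the monomial z_1^2⋯z_{i−1}^2 · z_i · z_{i+1}^2⋯z_{k−1}^2 belongs to BD_k + span(L_k^1 ∪ L_k^2). -/
open MvPolynomial

/-- The set of monomials `z₁^{m₁}⋯z_k^{m_k}` with all `m_j ∈ {0,1,2}`;
its span is the space `R_k = ℂ[z₁,…,z_k]_{≤2,…,2}`. -/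
def Rmonomials (k : ℕ) : Set (MvPolynomial (Fin k) ℂ) :=
  { m | ∃ e : Fin k →₀ ℕ, (∀ j, e j ≤ 2) ∧ m = monomial e 1 }

/-- The space `R_k = ℂ[z₁,…,z_k]_{≤2,…,2}`. -/
noncomputable def Rspace (k : ℕ) : Submodule ℂ (MvPolynomial (Fin k) ℂ) :=
  Submodule.span ℂ (Rmonomials k)

/-- The set `BD_k` of polynomials of `R_k` admitting a boundary decomposition
`p = (z₁+η)F₁ + ∑_{i=2}^k (z_{i−1}−z_i−1)F_i` with `F₁` invariant under `z₁ ↦ −z₁`,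
`(z₁+η)F₁ ∈ R_k`, each `F_i` (for `i ≥ 2`) invariant under exchanging `z_{i−1}, z_i`,
and `(z_{i−1}−z_i−1)F_i ∈ R_k`. -/
def BDset (k : ℕ) [NeZero k] (η : ℝ) : Set (MvPolynomial (Fin k) ℂ) :=
  { p | p ∈ Rspace k ∧
      ∃ F : Fin k → MvPolynomial (Fin k) ℂ,
        (aeval (fun j : Fin k => if j = 0 then -(X 0) else X j) (F 0) = F 0) ∧
        ((X 0 + C (η : ℂ)) * F 0 ∈ Rspace k) ∧
        (∀ i : Fin k, i ≠ 0 →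
          rename (Equiv.swap (i - 1) i) (F i) = F i ∧
            (X (i - 1) - X i - 1) * F i ∈ Rspace k) ∧
        p = (X 0 + C (η : ℂ)) * F 0 +
              ∑ i ∈ Finset.univ.filter (fun i : Fin k => i ≠ 0),
                (X (i - 1) - X i - 1) * F i }

/-- The linear map `L_{r,k}`: sum, over subsets `S` of `{1,…,k}` of size `k−r`, of the
substitution of `p` at the tuple whose coordinates in `S` (in increasing order) are
`−η, −η−1, …, −η−(k−r−1)` and whose remaining coordinates (in increasing order) are the
variables `x₁,…,x_r` (indexed here by `0,…,r−1` in `MvPolynomial ℕ ℂ`). -/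
noncomputable def Lmap (k : ℕ) (η : ℝ) (r : ℕ) (p : MvPolynomial (Fin k) ℂ) :
    MvPolynomial ℕ ℂ :=
  ∑ S ∈ Finset.powersetCard (k - r) (Finset.univ : Finset (Fin k)),
    aeval (fun j : Fin k =>
      if j ∈ S then C (-(η : ℂ) - ((S.filter (fun i => i < j)).card : ℂ))
      else X (((Finset.univ \ S).filter (fun i => i < j)).card)) p

/-- The set `SH_k`: polynomials `p ∈ R_k` such that for all `0 ≤ r ≤ k` the coefficient
of `x₁²⋯x_r²` in `L_{r,k}(p)` vanishes. -/
def SHset (k : ℕ) (η : ℝ) : Set (MvPolynomial (Fin k) ℂ) :=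
  { p | p ∈ Rspace k ∧
      ∀ r ≤ k, coeff (∑ i ∈ Finset.range r, Finsupp.single i 2) (Lmap k η r p) = 0 }

/-- The set `L_k^i` of monomials `z₁^{m₁}⋯z_k^{m_k}` with all `m_j ∈ {0,1,2}` and
exponent of `z_k` equal to `i`. -/
def Lset (k : ℕ) (i : ℕ) : Set (MvPolynomial (Fin k) ℂ) :=
  { m | ∃ e : Fin k →₀ ℕ, (∀ j, e j ≤ 2) ∧ (∀ j : Fin k, (j : ℕ) = k - 1 → e j = i) ∧
      m = monomial e 1 }

/-- The set `W_k` consisting of the monomial `z₁²⋯z_k²` together with, for each `j`, the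
monomial with exponent `2` in every variable except exponent `1` in `z_j`. -/
def Wset (k : ℕ) : Set (MvPolynomial (Fin k) ℂ) :=
  { m | m = monomial (Finsupp.equivFunOnFinite.symm fun _ : Fin k => 2) 1 ∨
      ∃ j : Fin k,
        m = monomial (Finsupp.equivFunOnFinite.symm fun i : Fin k => if i = j then 1 else 2) 1 }

theorem monomial_mem_Rspace {k : ℕ} {e : Fin k →₀ ℕ} (he : ∀ j, e j ≤ 2) :
    monomial e (1 : ℂ) ∈ Rspace k :=
  Submodule.subset_span ⟨e, he, rfl⟩

theorem X_pow_mul_monomial {k : ℕ} (i : Fin k) (a : ℕ) (e : Fin k →₀ ℕ) :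
    X i ^ a * monomial e (1 : ℂ) = monomial (Finsupp.single i a + e) 1 := by
  rw [X_pow_eq_monomial, monomial_mul, one_mul]

theorem X_pow_mul_monomial_mem_Rspace {k : ℕ} {i : Fin k} {a : ℕ} {e : Fin k →₀ ℕ}
    (ha : a ≤ 2) (he : ∀ j, e j ≤ 2) (hi : e i = 0) :
    X i ^ a * monomial e (1 : ℂ) ∈ Rspace k := by
  rw [X_pow_mul_monomial]
  refine monomial_mem_Rspace fun j => ?_
  by_cases h : i = j
  · subst h; simpa [hi] using ha
  · simpa [Finsupp.single_apply, h] using he j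

theorem rename_swap_monomial {k : ℕ} {i j : Fin k} {e : Fin k →₀ ℕ} (hi : e i = 0)
    (hj : e j = 0) :
    rename (Equiv.swap i j) (monomial e (1 : ℂ)) = monomial e 1 := by
  rw [rename_monomial, ← Finsupp.equivMapDomain_eq_mapDomain]
  congr 2
  ext l
  rw [Finsupp.equivMapDomain_apply, Equiv.symm_swap, Equiv.swap_apply_def]
  split_ifs with h₁ h₂
  · rw [h₁, hi, hj]
  · rw [h₂, hi, hj]
  · rfl

theorem X_zero_add_C_mem_BDset (k : ℕ) [NeZero k] (η : ℝ) :
    X 0 + C (η : ℂ) ∈ BDset k η := by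
  have h1 : (1 : MvPolynomial (Fin k) ℂ) ∈ Rspace k :=
    monomial_mem_Rspace (e := 0) (by simp)
  have hX : (X 0 : MvPolynomial (Fin k) ℂ) ∈ Rspace k := by
    simpa using X_pow_mul_monomial_mem_Rspace (i := (0 : Fin k)) (a := 1) (e := 0)
      (by norm_num) (by simp) rfl
  have h : X 0 + C (η : ℂ) ∈ Rspace k := by
    refine add_mem hX ?_
    simpa [smul_eq_C_mul] using Submodule.smul_mem _ (η : ℂ) h1
  refine ⟨h, Pi.single 0 1, by simp, by simpa using h, fun i hi => by simp [hi, zero_mem], ?_⟩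
  rw [Finset.sum_eq_zero]
  · simp
  · intro i hi
    simp [(Finset.mem_filter.1 hi).2]

theorem mul_mem_BDset {k : ℕ} [NeZero k] (η : ℝ) {i : Fin k} (hi : i ≠ 0)
    {f : MvPolynomial (Fin k) ℂ} (hf : rename (Equiv.swap (i - 1) i) f = f)
    (hR : (X (i - 1) - X i - 1) * f ∈ Rspace k) :
    (X (i - 1) - X i - 1) * f ∈ BDset k η := by
  refine ⟨hR, Pi.single i f, by simp [hi.symm], by simp [hi.symm, zero_mem], fun j _ => ?_, ?_⟩
  · by_cases h : j = i
    · subst h; simpa using ⟨hf, hR⟩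
    · simp [h, zero_mem]
  · rw [Finset.sum_eq_single i]
    · simp [hi.symm]
    · intro j _ h
      simp [h]
    · simp [hi]

/-- Modulo `BD_k + span(L_k¹ ∪ L_k²)`, the variable `z_{k-n}` acts as the scalar `n` on
monomials in the preceding variables. -/
theorem X_sub_mul_monomial_mem (k : ℕ) [NeZero k] (η : ℝ) (n : ℕ) :
    ∀ (j : Fin k) (e : Fin k →₀ ℕ), (j : ℕ) + n = k - 1 → (∀ l, e l ≤ 2) →
      (∀ l, j ≤ l → e l = 0) →
      (X j - C (n : ℂ)) * monomial e 1
          ∈ Submodule.span ℂ (BDset k η) ⊔ Submodule.span ℂ (Lset k 1 ∪ Lset k 2) ∧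
      (X j - C (n : ℂ)) * X j * monomial e 1
          ∈ Submodule.span ℂ (BDset k η) ⊔ Submodule.span ℂ (Lset k 1 ∪ Lset k 2) := by
  induction n with
  | zero =>
    intro j e hj he h0
    have key : ∀ a ≤ 2, X j ^ a * monomial e (1 : ℂ) ∈ Lset k a := by
      intro a ha
      refine ⟨Finsupp.single j a + e, fun l => ?_, fun l hl => ?_, X_pow_mul_monomial ..⟩
      · by_cases h : j = l
        · subst h; simpa [h0 j le_rfl] using ha
        · simpa [Finsupp.single_apply, h] using he l
      · obtain rfl : l = j := Fin.ext (by omega)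
        simp [h0 l le_rfl]
    refine ⟨Submodule.mem_sup_right (Submodule.subset_span (Or.inl ?_)),
      Submodule.mem_sup_right (Submodule.subset_span (Or.inr ?_))⟩
    · simpa using key 1 (by norm_num)
    · simpa [pow_two] using key 2 le_rfl
  | succ n ih =>
    intro j e hj he h0
    have hk : (j : ℕ) + 1 < k := by omega
    obtain ⟨i, hi⟩ : ∃ i : Fin k, (i : ℕ) = j + 1 := ⟨⟨j + 1, hk⟩, rfl⟩
    have hi0 : i ≠ 0 := by
      rintro rfl
      simp at hi
    have hij : i - 1 = j := Fin.ext (by rw [Fin.val_sub_one_of_ne_zero hi0]; omega)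
    have hji : j ≤ i := Fin.le_def.2 (by omega)
    obtain ⟨ih1, ih2⟩ := ih i e (by omega) he fun l hl => h0 l (hji.trans hl)
    have hej := h0 j le_rfl
    have hei := h0 i hji
    have hsym : rename (Equiv.swap (i - 1) i) (monomial e (1 : ℂ)) = monomial e 1 :=
      rename_swap_monomial (by rw [hij, hej]) hei
    have hm (l : Fin k) (hl : e l = 0) (a : ℕ) (ha : a ≤ 2) :=
      X_pow_mul_monomial_mem_Rspace ha he hl
    have b1 := mul_mem_BDset η hi0 hsym (by
      rw [hij]
      convert sub_mem (sub_mem (hm j hej 1 (by norm_num)) (hm i hei 1 (by norm_num)))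
        (hm i hei 0 (by norm_num)) using 1
      ring)
    have b2 := mul_mem_BDset η hi0 (f := (X (i - 1) + X i) * monomial e 1) (by
      rw [map_mul, hsym, map_add, rename_X, rename_X, Equiv.swap_apply_left,
        Equiv.swap_apply_right, add_comm (X i)]) (by
      rw [hij]
      convert sub_mem (sub_mem (hm j hej 2 le_rfl) (hm i hei 2 le_rfl))
        (add_mem (hm j hej 1 (by norm_num)) (hm i hei 1 (by norm_num))) using 1
      ring)
    rw [hij] at b1 b2
    replace b1 := Submodule.mem_sup_left (T := Submodule.span ℂ (Lset k 1 ∪ Lset k 2))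
      (Submodule.subset_span (R := ℂ) b1)
    replace b2 := Submodule.mem_sup_left (T := Submodule.span ℂ (Lset k 1 ∪ Lset k 2))
      (Submodule.subset_span (R := ℂ) b2)
    have h1 : (X j - C ((n + 1 : ℕ) : ℂ)) * monomial e 1
        ∈ Submodule.span ℂ (BDset k η) ⊔ Submodule.span ℂ (Lset k 1 ∪ Lset k 2) := by
      convert add_mem b1 ih1 using 1
      push_cast
      rw [C_add, C_1]
      ring
    refine ⟨h1, ?_⟩
    convert sub_mem (add_mem (add_mem b2 ih2) (Submodule.smul_mem _ ((n : ℂ) + 1) ih1))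
      (Submodule.smul_mem _ (n : ℂ) h1) using 1
    simp only [smul_eq_C_mul]
    push_cast
    rw [C_add, C_1]
    ring

theorem one_mem_sup (k : ℕ) [NeZero k] {η : ℝ} (hη : 0 < η) :
    (1 : MvPolynomial (Fin k) ℂ)
      ∈ Submodule.span ℂ (BDset k η) ⊔ Submodule.span ℂ (Lset k 1 ∪ Lset k 2) := by
  have h1 := (X_sub_mul_monomial_mem k η (k - 1) 0 0 (by simp) (by simp) (by simp)).1
  have h2 := Submodule.mem_sup_left (T := Submodule.span ℂ (Lset k 1 ∪ Lset k 2))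
    (Submodule.subset_span (R := ℂ) (X_zero_add_C_mem_BDset k η))
  have hne : (η : ℂ) + ((k - 1 : ℕ) : ℂ) ≠ 0 := by
    have : η + ((k - 1 : ℕ) : ℝ) ≠ 0 := by positivity
    exact_mod_cast this
  rw [← Submodule.smul_mem_iff _ hne]
  convert sub_mem h2 h1 using 1
  rw [smul_eq_C_mul, C_add, monomial_zero', C_1]
  ring

theorem monomial_mem_sup (k : ℕ) [NeZero k] {η : ℝ} (hη : 0 < η) (n : ℕ) :
    ∀ e : Fin k →₀ ℕ, (∀ l, e l ≤ 2) → (∀ l : Fin k, n ≤ (l : ℕ) → e l = 0) →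
      monomial e (1 : ℂ)
        ∈ Submodule.span ℂ (BDset k η) ⊔ Submodule.span ℂ (Lset k 1 ∪ Lset k 2) := by
  induction n with
  | zero =>
    intro e _ h0
    obtain rfl : e = 0 := Finsupp.ext fun l => h0 l (Nat.zero_le _)
    exact one_mem_sup k hη
  | succ n ih =>
    intro e he h0
    by_cases hn : n < k
    · obtain ⟨j, hj⟩ : ∃ j : Fin k, (j : ℕ) = n := ⟨⟨n, hn⟩, rfl⟩
      have he' : ∀ l, e.erase j l ≤ 2 := fun l => by
        rw [Finsupp.erase_apply]
        split_ifs
        · exact Nat.zero_le _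
        · exact he l
      have h0' : ∀ l : Fin k, n ≤ (l : ℕ) → e.erase j l = 0 := fun l hl => by
        rw [Finsupp.erase_apply]
        split_ifs with h
        · rfl
        · exact h0 l (by have := Fin.val_ne_of_ne h; omega)
      have hq := ih _ he' h0'
      obtain ⟨h1, h2⟩ := X_sub_mul_monomial_mem k η (k - 1 - n) j _ (by omega) he'
        fun l hl => h0' l (hj ▸ Fin.le_def.1 hl)
      rw [← Finsupp.single_add_erase j e, ← X_pow_mul_monomial]
      have hX : X j * monomial (e.erase j) (1 : ℂ)
          ∈ Submodule.span ℂ (BDset k η) ⊔ Submodule.span ℂ (Lset k 1 ∪ Lset k 2) := by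
        convert add_mem h1 (Submodule.smul_mem _ ((k - 1 - n : ℕ) : ℂ) hq) using 1
        rw [smul_eq_C_mul]
        ring
      obtain h | h | h : e j = 0 ∨ e j = 1 ∨ e j = 2 := by have := he j; omega
      · rwa [h, pow_zero, one_mul]
      · rwa [h, pow_one]
      · rw [h]
        convert add_mem h2 (Submodule.smul_mem _ ((k - 1 - n : ℕ) : ℂ) hX) using 1
        rw [smul_eq_C_mul]
        ring
    · exact ih e he fun l hl => absurd l.isLt (by omega)

theorem prod_X_pow_mem_sup (k : ℕ) [NeZero k] {η : ℝ} (hη : 0 < η) (f : Fin k → ℕ)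
    (hf : ∀ j, f j ≤ 2) :
    ∏ j, X j ^ f j
      ∈ Submodule.span ℂ (BDset k η) ⊔ Submodule.span ℂ (Lset k 1 ∪ Lset k 2) := by
  have h := monomial_mem_sup k hη k (Finsupp.equivFunOnFinite.symm f) hf
    fun l hl => absurd l.isLt (by omega)
  rw [monomial_eq, C_1, one_mul, Finsupp.prod_fintype _ _ fun _ => pow_zero _] at h
  exact h

/-- Proposition 4.12 of the paper: `z₁²⋯z_{k−1}² ∈ BD_k + span(L_k¹ ∪ L_k²)`, and for
`1 ≤ i ≤ k−1`, `z₁²⋯z_{i−1}² z_i z_{i+1}²⋯z_{k−1}² ∈ BD_k + span(L_k¹ ∪ L_k²)`. -/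
theorem condition_III (k : ℕ) [NeZero k] (η : ℝ) (hη : 0 < η) :
    ((∏ j ∈ Finset.univ.filter (fun j : Fin k => (j : ℕ) < k - 1), X j ^ 2)
      ∈ Submodule.span ℂ (BDset k η) ⊔ Submodule.span ℂ (Lset k 1 ∪ Lset k 2)) ∧
    ∀ (i : ℕ) (hi1 : 1 ≤ i) (hi2 : i ≤ k - 1),
      (∏ j ∈ Finset.univ.filter (fun j : Fin k => (j : ℕ) < i - 1), X j ^ 2) *
          X (⟨i - 1, by omega⟩ : Fin k) *
          (∏ j ∈ Finset.univ.filter (fun j : Fin k => i ≤ (j : ℕ) ∧ (j : ℕ) < k - 1), X j ^ 2)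
        ∈ Submodule.span ℂ (BDset k η) ⊔ Submodule.span ℂ (Lset k 1 ∪ Lset k 2) := by
  constructor
  · convert prod_X_pow_mem_sup k hη (fun j => if (j : ℕ) < k - 1 then 2 else 0)
      (fun j => by split_ifs <;> omega) using 1
    rw [Finset.prod_filter]
    refine Finset.prod_congr rfl fun j _ => ?_
    split_ifs <;> simp
  · intro i hi1 hi2
    convert prod_X_pow_mem_sup k hη
      (fun j => if (j : ℕ) < i - 1 then 2 else if (j : ℕ) = i - 1 then 1 else
        if (j : ℕ) < k - 1 then 2 else 0) (fun j => by split_ifs <;> omega) using 1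
    have hX : (X (⟨i - 1, by omega⟩ : Fin k) : MvPolynomial (Fin k) ℂ)
        = ∏ j, if j = (⟨i - 1, by omega⟩ : Fin k) then X j else 1 := by simp
    rw [hX, Finset.prod_filter, Finset.prod_filter, ← Finset.prod_mul_distrib,
      ← Finset.prod_mul_distrib]
    refine Finset.prod_congr rfl fun j _ => ?_
    simp only [Fin.ext_iff]
    split_ifs <;> first | omega | simp
end

section
/- Let ν > 1/2 be real. Let X and Z be random variables on a probability space (Ω,𝔽,ℙ) such that X ≥ 0 almost surely, Z has law Gamma(ν), and X and Z are independent. Then for every real t ≥ 0, the random variable F_ν(−t·Z·X) is integrable, the random variable e^{−tX} is integrable, and 𝔼[F_ν(−t·Z·X)] = 𝔼[e^{−tX}]. -/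
open MeasureTheory ProbabilityTheory Filter Topology

/-- The function `F_ν(x) = ∑_{k=0}^∞ x^k/(k!·(ν)_k)`, where `(ν)_k` is the Pochhammer
symbol. -/
noncomputable def Fnu (ν : ℝ) (x : ℝ) : ℝ :=
  ∑' k : ℕ, x ^ k / (k.factorial * (ascPochhammer ℝ k).eval ν)

theorem ascPochhammer_eval_succ_left (ν : ℝ) (k : ℕ) :
    (ascPochhammer ℝ (k + 1)).eval ν = ν * (ascPochhammer ℝ k).eval (ν + 1) := by
  simp [ascPochhammer_succ_left]

theorem min_one_le_ascPochhammer_eval {ν : ℝ} (hν : 0 < ν) (k : ℕ) :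
    min 1 ν ≤ (ascPochhammer ℝ k).eval ν := by
  have one_le : ∀ (k : ℕ) (μ : ℝ), 1 ≤ μ → 1 ≤ (ascPochhammer ℝ k).eval μ := by
    intro k μ hμ
    induction k with
    | zero => simp
    | succ k ih =>
      rw [ascPochhammer_succ_eval]
      exact one_le_mul_of_one_le_of_one_le ih (by linarith [(Nat.cast_nonneg k : (0 : ℝ) ≤ k)])
  cases k with
  | zero => simp
  | succ k =>
    rw [ascPochhammer_eval_succ_left]
    exact (min_le_right _ _).trans
      (le_mul_of_one_le_right hν.le (one_le k (ν + 1) (by linarith)))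

theorem abs_Fnu_term_le {ν : ℝ} (hν : 0 < ν) {x R : ℝ} (hx : |x| ≤ R) (k : ℕ) :
    |x ^ k / (k.factorial * (ascPochhammer ℝ k).eval ν)| ≤
      R ^ k / k.factorial * (min 1 ν)⁻¹ := by
  have hm : 0 < min 1 ν := lt_min one_pos hν
  have hp := min_one_le_ascPochhammer_eval hν k
  have hf : (0 : ℝ) < k.factorial := by positivity
  rw [abs_div, abs_pow, abs_of_pos (mul_pos hf (hm.trans_le hp)), ← div_div,
    div_eq_mul_inv _ (Polynomial.eval _ _)]
  have hR : 0 ≤ R := (abs_nonneg x).trans hx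
  have hinv : ((ascPochhammer ℝ k).eval ν)⁻¹ ≤ (min 1 ν)⁻¹ := inv_anti₀ hm hp
  have : |x| ^ k / k.factorial ≤ R ^ k / k.factorial := by gcongr
  exact mul_le_mul this hinv (inv_pos.mpr (hm.trans_le hp)).le (by positivity)

theorem summable_Fnu {ν : ℝ} (hν : 0 < ν) (x : ℝ) :
    Summable fun k : ℕ => x ^ k / (k.factorial * (ascPochhammer ℝ k).eval ν) :=
  .of_norm_bounded ((Real.summable_pow_div_factorial |x|).mul_right _)
    (abs_Fnu_term_le hν le_rfl)

theorem Fnu_zero (ν : ℝ) : Fnu ν 0 = 1 := by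
  rw [Fnu, tsum_eq_single 0]
  · simp
  · intro k hk
    simp [hk]

theorem hasDerivAt_Fnu {ν : ℝ} (hν : 0 < ν) (x : ℝ) :
    HasDerivAt (Fnu ν) (Fnu (ν + 1) x / ν) x := by
  have hterm : ∀ (k : ℕ) (y : ℝ),
      ((k + 1 : ℕ) : ℝ) * y ^ k / ((k + 1).factorial * (ascPochhammer ℝ (k + 1)).eval ν) =
        y ^ k / (k.factorial * (ascPochhammer ℝ k).eval (ν + 1)) / ν := by
    intro k y
    have hp := (lt_min one_pos (by linarith : 0 < ν + 1)).trans_le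
      (min_one_le_ascPochhammer_eval (by linarith : 0 < ν + 1) k)
    rw [ascPochhammer_eval_succ_left, Nat.factorial_succ]
    push_cast
    field_simp
  have hsplit : ∀ y, Fnu ν y = 1 + ∑' k : ℕ,
      y ^ (k + 1) / ((k + 1).factorial * (ascPochhammer ℝ (k + 1)).eval ν) := by
    intro y
    rw [Fnu, (summable_Fnu hν y).tsum_eq_zero_add]
    simp
  rw [funext hsplit, Fnu, ← tsum_div_const]
  refine HasDerivAt.const_add _ ?_
  have hν1 : 0 < ν + 1 := by linarith
  refine hasDerivAt_tsum_of_isPreconnected (𝕜 := ℝ) (F := ℝ)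
    (g := fun k y => y ^ (k + 1) / ((k + 1).factorial * (ascPochhammer ℝ (k + 1)).eval ν))
    (g' := fun k y => y ^ k / (k.factorial * (ascPochhammer ℝ k).eval (ν + 1)) / ν)
    (u := fun k : ℕ => (|x| + 1) ^ k / k.factorial * (min 1 (ν + 1))⁻¹ / ν)
    (t := Metric.ball (0 : ℝ) (|x| + 1)) (y₀ := (0 : ℝ))
    (((Real.summable_pow_div_factorial _).mul_right _).div_const _)
    Metric.isOpen_ball (convex_ball _ _).isPreconnected ?_ ?_ ?_ ?_ ?_
  · intro k y _
    rw [← hterm]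
    simpa using (hasDerivAt_pow (k + 1) y).div_const _
  · intro k y hy
    rw [norm_div, Real.norm_of_nonneg hν.le]
    gcongr
    exact abs_Fnu_term_le hν1 (by simpa using (mem_ball_zero_iff.mp hy).le) k
  · simp; positivity
  · exact (summable_nat_add_iff 1).mpr (summable_Fnu hν 0)
  · simp

theorem Fnu_contiguous {ν : ℝ} (hν : 0 < ν) (x : ℝ) :
    x * (Fnu (ν + 1 + 1) x / (ν + 1) / ν) + Fnu (ν + 1) x = Fnu ν x := by
  have hν1 : 0 < ν + 1 := by linarith
  have hν2 : 0 < ν + 1 + 1 := by linarith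
  have h0 := (summable_Fnu hν x).tsum_eq_zero_add
  have h1 := (summable_Fnu hν1 x).tsum_eq_zero_add
  have hs0 := (summable_nat_add_iff 1).mpr (summable_Fnu hν x)
  have hs1 := (summable_nat_add_iff 1).mpr (summable_Fnu hν1 x)
  have hsub := hs0.tsum_sub hs1
  have hkey : ∑' k : ℕ, (x ^ (k + 1) / ((k + 1).factorial * (ascPochhammer ℝ (k + 1)).eval ν) -
      x ^ (k + 1) / ((k + 1).factorial * (ascPochhammer ℝ (k + 1)).eval (ν + 1))) =
      x * (Fnu (ν + 1 + 1) x / (ν + 1) / ν) := by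
    rw [Fnu, ← tsum_div_const, ← tsum_div_const, ← tsum_mul_left]
    refine tsum_congr fun k => ?_
    have hp1 := (lt_min one_pos hν1).trans_le (min_one_le_ascPochhammer_eval hν1 k)
    have hp2 := (lt_min one_pos hν2).trans_le (min_one_le_ascPochhammer_eval hν2 k)
    have hrel : (ν + 1) * (ascPochhammer ℝ k).eval (ν + 1 + 1) =
        (ascPochhammer ℝ k).eval (ν + 1) * (ν + 1 + k) := by
      rw [← ascPochhammer_eval_succ_left, ascPochhammer_succ_eval]
    have hp : (ascPochhammer ℝ k).eval (ν + 1 + 1) =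
        (ascPochhammer ℝ k).eval (ν + 1) * (ν + 1 + k) / (ν + 1) := by
      rw [← hrel]
      field_simp
    have hk : 0 < ν + 1 + k := by positivity
    rw [ascPochhammer_eval_succ_left, ascPochhammer_eval_succ_left, Nat.factorial_succ, hp]
    push_cast
    field_simp
    ring
  rw [← hkey, hsub, Fnu, Fnu, h0, h1]
  simp [add_comm]

theorem continuous_Fnu {ν : ℝ} (hν : 0 < ν) : Continuous (Fnu ν) :=
  continuous_iff_continuousAt.mpr fun x => (hasDerivAt_Fnu hν x).continuousAt

/-- Writing `g y = Fnu ν (-y)`, the energy `g ^ 2 + y * (deriv g) ^ 2` is nonincreasing on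
`[0, ∞)`, so `g` is bounded by its initial value. -/
theorem abs_Fnu_neg_le_one {ν : ℝ} (hν : 1 / 2 ≤ ν) {y : ℝ} (hy : 0 ≤ y) :
    |Fnu ν (-y)| ≤ 1 := by
  have hν0 : 0 < ν := by linarith
  have hν1 : 0 < ν + 1 := by linarith
  have hderiv : ∀ z : ℝ, HasDerivAt
      (fun z => Fnu ν (-z) ^ 2 + z * (Fnu (ν + 1) (-z) / ν) ^ 2)
      ((1 - 2 * ν) * (Fnu (ν + 1) (-z) / ν) ^ 2) z := by
    intro z
    have h0 := (hasDerivAt_Fnu hν0 (-z)).comp z (hasDerivAt_neg z)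
    have h1 := ((hasDerivAt_Fnu hν1 (-z)).comp z (hasDerivAt_neg z)).div_const ν
    refine ((h0.pow 2).add ((hasDerivAt_id z).mul (h1.pow 2))).congr_deriv ?_
    have hode := Fnu_contiguous hν0 (-z)
    simp only [Function.comp_apply, Pi.pow_apply, id]
    have hB : Fnu (ν + 1) (-z) = ν * (Fnu (ν + 1) (-z) / ν) := by field_simp
    rw [← hode]
    generalize Fnu (ν + 1) (-z) / ν = b at *
    rw [hB]
    ring
  have hanti : AntitoneOn (fun z => Fnu ν (-z) ^ 2 + z * (Fnu (ν + 1) (-z) / ν) ^ 2)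
      (Set.Ici 0) := by
    refine antitoneOn_of_deriv_nonpos (convex_Ici 0)
      (fun z _ => (hderiv z).continuousAt.continuousWithinAt)
      (fun z _ => (hderiv z).differentiableAt.differentiableWithinAt) fun z _ => ?_
    rw [(hderiv z).deriv]
    exact mul_nonpos_of_nonpos_of_nonneg (by linarith) (sq_nonneg _)
  have hle := hanti Set.self_mem_Ici hy hy
  simp only [neg_zero, Fnu_zero, zero_mul, add_zero] at hle
  rw [← sq_le_one_iff_abs_le_one]
  nlinarith [mul_nonneg hy (sq_nonneg (Fnu (ν + 1) (-y) / ν))]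

theorem Gamma_add_natCast {ν : ℝ} (hν : 0 < ν) (k : ℕ) :
    Real.Gamma (ν + k) = (ascPochhammer ℝ k).eval ν * Real.Gamma ν := by
  induction k with
  | zero => simp
  | succ k ih =>
    rw [Nat.cast_succ, ← add_assoc, Real.Gamma_add_one (by positivity), ih,
      ascPochhammer_succ_eval]
    ring

theorem ae_nonneg_gammaMeasure (ν r : ℝ) : ∀ᵐ z ∂gammaMeasure ν r, 0 ≤ z := by
  have hmeas : Measurable (gammaPDF ν r) := (measurable_gammaPDFReal ν r).ennreal_ofReal
  rw [gammaMeasure, ae_withDensity_iff hmeas]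
  refine ae_of_all _ fun z hz => ?_
  contrapose! hz
  exact gammaPDF_of_neg hz

theorem gammaPDFReal_mul_pow (ν : ℝ) (k : ℕ) :
    (fun z => gammaPDFReal ν 1 z * z ^ k) =ᵐ[volume] (Set.Ioi 0).indicator
      fun z => (Real.Gamma ν)⁻¹ * (Real.exp (-z) * z ^ (ν + k - 1)) := by
  filter_upwards [Measure.ae_ne volume (0 : ℝ)] with z hz
  rcases lt_or_gt_of_ne hz with hneg | hpos
  · simp [gammaPDFReal, hneg.not_ge, hneg.le]
  · have hpow : z ^ (ν + k - 1) = z ^ (ν - 1) * z ^ k := by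
      rw [← Real.rpow_natCast, ← Real.rpow_add hpos]
      ring_nf
    simp only [gammaPDFReal, hpos.le, if_true, Set.indicator, Set.mem_Ioi, hpos, hpow]
    simp
    ring

theorem integrable_pow_gammaMeasure {ν : ℝ} (hν : 0 < ν) (k : ℕ) :
    Integrable (fun z => z ^ k) (gammaMeasure ν 1) := by
  have hmeas : Measurable (gammaPDF ν 1) := (measurable_gammaPDFReal ν 1).ennreal_ofReal
  rw [gammaMeasure, integrable_withDensity_iff_integrable_smul' hmeas
    (ae_of_all _ fun _ => ENNReal.ofReal_lt_top)]
  simp only [gammaPDF, ENNReal.toReal_ofReal (gammaPDFReal_nonneg hν one_pos _), smul_eq_mul]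
  rw [integrable_congr (gammaPDFReal_mul_pow ν k), integrable_indicator_iff measurableSet_Ioi]
  exact (Real.GammaIntegral_convergent (by positivity)).const_mul _

theorem integral_pow_gammaMeasure {ν : ℝ} (hν : 0 < ν) (k : ℕ) :
    ∫ z, z ^ k ∂gammaMeasure ν 1 = (ascPochhammer ℝ k).eval ν := by
  have hmeas : Measurable (gammaPDF ν 1) := (measurable_gammaPDFReal ν 1).ennreal_ofReal
  rw [gammaMeasure, integral_withDensity_eq_integral_toReal_smul hmeas
    (ae_of_all _ fun _ => ENNReal.ofReal_lt_top)]
  simp only [gammaPDF, ENNReal.toReal_ofReal (gammaPDFReal_nonneg hν one_pos _), smul_eq_mul]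
  rw [integral_congr_ae (gammaPDFReal_mul_pow ν k), integral_indicator measurableSet_Ioi,
    integral_const_mul, ← Real.Gamma_eq_integral (by positivity), Gamma_add_natCast hν]
  have := (Real.Gamma_pos_of_pos hν).ne'
  field_simp

theorem integral_Fnu_mul_gammaMeasure {ν : ℝ} (hν : 0 < ν) (s : ℝ) :
    ∫ z, Fnu ν (s * z) ∂gammaMeasure ν 1 = Real.exp s := by
  have hp : ∀ k : ℕ, 0 < (ascPochhammer ℝ k).eval ν := fun k => ascPochhammer_pos k ν hν
  have hterm : ∀ (k : ℕ) (c z : ℝ),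
      (c * z) ^ k / (k.factorial * (ascPochhammer ℝ k).eval ν) =
        c ^ k / (k.factorial * (ascPochhammer ℝ k).eval ν) * z ^ k := by
    intro k c z
    rw [mul_pow]
    ring
  have hint : ∀ (k : ℕ) (c : ℝ),
      ∫ z, (c * z) ^ k / (k.factorial * (ascPochhammer ℝ k).eval ν) ∂gammaMeasure ν 1 =
        c ^ k / k.factorial := by
    intro k c
    simp only [hterm]
    rw [integral_const_mul, integral_pow_gammaMeasure hν]
    have := (hp k).ne'
    field_simp
  have hnorm : ∀ k : ℕ,
      ∫ z, ‖(s * z) ^ k / (k.factorial * (ascPochhammer ℝ k).eval ν)‖ ∂gammaMeasure ν 1 =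
        |s| ^ k / k.factorial := by
    intro k
    rw [← hint]
    refine integral_congr_ae ?_
    filter_upwards [ae_nonneg_gammaMeasure ν 1] with z hz
    have hf : (0 : ℝ) < k.factorial := by positivity
    rw [norm_div, norm_pow, norm_mul, Real.norm_of_nonneg (mul_pos hf (hp k)).le,
      Real.norm_of_nonneg hz, Real.norm_eq_abs]
  have hsum := integral_tsum_of_summable_integral_norm (μ := gammaMeasure ν 1)
    (F := fun (k : ℕ) z => (s * z) ^ k / (k.factorial * (ascPochhammer ℝ k).eval ν))
    (fun k => by
      simp only [hterm]
      exact (integrable_pow_gammaMeasure hν k).const_mul _)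
    (by simpa only [hnorm] using Real.summable_pow_div_factorial |s|)
  simp only [hint] at hsum
  rw [Real.exp_eq_exp_ℝ, NormedSpace.exp_eq_tsum_div]
  exact hsum.symm

/-- Lemma 4.16 of the paper: if `X ≥ 0` a.s., `Z ∼ Gamma(ν)` is independent of `X`, and
`t ≥ 0`, then `𝔼[F_ν(−tZX)] = 𝔼[e^{−tX}]`, both sides being finite. -/
theorem Fnu_transform_eq_laplace {Ω : Type*} [MeasureSpace Ω]
    [IsProbabilityMeasure (ℙ : Measure Ω)]
    (ν : ℝ) (hν : 1 / 2 < ν) (X Z : Ω → ℝ) (hX : Measurable X) (hZ : Measurable Z)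
    (hXpos : ∀ᵐ ω ∂ℙ, 0 ≤ X ω)
    (hZlaw : Measure.map Z ℙ = gammaMeasure ν 1)
    (hindep : IndepFun X Z ℙ)
    (t : ℝ) (ht : 0 ≤ t) :
    Integrable (fun ω => Fnu ν (-t * Z ω * X ω)) ℙ ∧
    Integrable (fun ω => Real.exp (-t * X ω)) ℙ ∧
    ∫ ω, Fnu ν (-t * Z ω * X ω) ∂ℙ = ∫ ω, Real.exp (-t * X ω) ∂ℙ := by
  have hν0 : 0 < ν := by linarith
  have := isProbabilityMeasure_gammaMeasure hν0 one_pos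
  have := Measure.isProbabilityMeasure_map (μ := ℙ) hX.aemeasurable
  have hXZ : AEMeasurable (fun ω => (X ω, Z ω)) ℙ := (hX.prodMk hZ).aemeasurable
  have hjoint : Measure.map (fun ω => (X ω, Z ω)) ℙ =
      (Measure.map X ℙ).prod (gammaMeasure ν 1) := by
    rw [← hZlaw]
    exact (indepFun_iff_map_prod_eq_prod_map_map hX.aemeasurable hZ.aemeasurable).mp hindep
  have hZpos : ∀ᵐ ω ∂ℙ, 0 ≤ Z ω :=
    ae_of_ae_map hZ.aemeasurable (hZlaw ▸ ae_nonneg_gammaMeasure ν 1)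
  have hcont : Continuous fun p : ℝ × ℝ => Fnu ν (-t * p.2 * p.1) :=
    (continuous_Fnu hν0).comp (by fun_prop)
  have hF : Integrable (fun ω => Fnu ν (-t * Z ω * X ω)) ℙ := by
    refine Integrable.of_bound (hcont.measurable.comp (hX.prodMk hZ)).aestronglyMeasurable 1 ?_
    filter_upwards [hXpos, hZpos] with ω hx hz
    rw [neg_mul, neg_mul]
    exact abs_Fnu_neg_le_one hν.le (by positivity)
  refine ⟨hF, ?_, ?_⟩
  · refine Integrable.of_bound (by fun_prop) 1 ?_
    filter_upwards [hXpos] with ω hx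
    rw [Real.norm_of_nonneg (Real.exp_pos _).le, Real.exp_le_one_iff, neg_mul]
    exact neg_nonpos.mpr (by positivity)
  · have hFprod : Integrable (fun p : ℝ × ℝ => Fnu ν (-t * p.2 * p.1))
        ((Measure.map X ℙ).prod (gammaMeasure ν 1)) := by
      rw [← hjoint]
      exact (integrable_map_measure hcont.aestronglyMeasurable hXZ).mpr hF
    calc ∫ ω, Fnu ν (-t * Z ω * X ω) ∂ℙ
        = ∫ p : ℝ × ℝ, Fnu ν (-t * p.2 * p.1) ∂(Measure.map X ℙ).prod (gammaMeasure ν 1) := by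
          rw [← hjoint, integral_map hXZ hcont.aestronglyMeasurable]
      _ = ∫ x, ∫ z, Fnu ν (-t * z * x) ∂gammaMeasure ν 1 ∂Measure.map X ℙ :=
          integral_prod _ hFprod
      _ = ∫ x, Real.exp (-t * x) ∂Measure.map X ℙ := by
          simp only [mul_right_comm (-t), integral_Fnu_mul_gammaMeasure hν0]
      _ = ∫ ω, Real.exp (-t * X ω) ∂ℙ :=
          integral_map hX.aemeasurable (by fun_prop)
end
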